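/- (Perfect matching for Algorithm 1.) For every subset C ⊆ Fin n with |C| = k_A, there exists a bijection f from C onto ZMod k_A such that f(c) ∈ T_c for every c ∈ C; that is, the family (T_c)_{c∈C} admits a system of distinct representatives covering all k_A unknowns. -/

import Mathlib

/-- The cyclic interval `{a, a+1, …, a+ω−1}` of length `ω` starting at `a` in `ZMod k`. -/
def Icyc (k ω : ℕ) (a : ZMod k) : Finset (ZMod k) :=
  (Finset.range ω).image (fun j : ℕ => a + (j : ZMod k))

/-- The support assignment of Algorithm 1: client `i < k_A` gets the cyclic interval of
length `ω_A = s+1` starting at `i`, and passive client `k_A + j` gets the one starting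
at `j`. -/
def Tsup (kA s : ℕ) (c : Fin (kA + s)) : Finset (ZMod kA) :=
  if (c : ℕ) < kA then Icyc kA (s + 1) ((c : ℕ) : ZMod kA)
  else Icyc kA (s + 1) (((c : ℕ) - kA : ℕ) : ZMod kA)

theorem ZMod.finset_eq_univ_of_add_one_mem {k : ℕ} [NeZero k] {E : Finset (ZMod k)}
    (hne : E.Nonempty) (h : ∀ x ∈ E, x + 1 ∈ E) : E = Finset.univ := by
  obtain ⟨x, hx⟩ := hne
  have key : ∀ n : ℕ, x + n ∈ E := by
    intro n
    induction n with
    | zero => simpa using hx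
    | succ n ih => simpa [add_assoc] using h _ ih
  refine Finset.eq_univ_of_forall fun y => ?_
  simpa using key (y - x).val

theorem mem_Icyc {k ω : ℕ} {a x : ZMod k} :
    x ∈ Icyc k ω a ↔ ∃ j < ω, a + (j : ZMod k) = x := by
  simp [Icyc]

theorem Icyc_mono {k ω ω' : ℕ} (h : ω ≤ ω') (a : ZMod k) : Icyc k ω a ⊆ Icyc k ω' a :=
  Finset.image_subset_image (Finset.range_mono h)

theorem add_one_mem_Icyc_succ {k ω : ℕ} {a x : ZMod k} (hx : x ∈ Icyc k ω a) :
    x + 1 ∈ Icyc k (ω + 1) a := by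
  obtain ⟨j, hj, rfl⟩ := mem_Icyc.1 hx
  exact mem_Icyc.2 ⟨j + 1, by omega, by push_cast; ring⟩

/-- Cauchy–Davenport type bound for a sumset with a cyclic interval. -/
theorem min_le_card_biUnion_Icyc {k : ℕ} [NeZero k] {D : Finset (ZMod k)} (hD : D.Nonempty)
    (s : ℕ) : min k (D.card + s) ≤ (D.biUnion (Icyc k (s + 1))).card := by
  induction s with
  | zero =>
    refine (min_le_right _ _).trans (Finset.card_le_card fun a ha => ?_)
    exact Finset.mem_biUnion.2 ⟨a, ha, mem_Icyc.2 ⟨0, by omega, by simp⟩⟩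
  | succ s ih =>
    set E := D.biUnion (Icyc k (s + 1))
    set F := D.biUnion (Icyc k (s + 1 + 1))
    have hEF : E ⊆ F := Finset.biUnion_mono fun a _ => Icyc_mono (Nat.le_succ _) a
    have hshift : ∀ x ∈ E, x + 1 ∈ F := fun x hx => by
      obtain ⟨a, ha, hxa⟩ := Finset.mem_biUnion.1 hx
      exact Finset.mem_biUnion.2 ⟨a, ha, add_one_mem_Icyc_succ hxa⟩
    have hEne : E.Nonempty := by
      obtain ⟨a, ha⟩ := hD
      exact ⟨a, Finset.mem_biUnion.2 ⟨a, ha, mem_Icyc.2 ⟨0, by omega, by simp⟩⟩⟩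
    rcases hEF.eq_or_ssubset with h | h
    · have hu := ZMod.finset_eq_univ_of_add_one_mem hEne fun x hx => h ▸ hshift x hx
      rw [← h, hu, Finset.card_univ, ZMod.card]
      exact min_le_left _ _
    · have := Finset.card_lt_card h
      omega

theorem Tsup_eq_Icyc (kA s : ℕ) (c : Fin (kA + s)) :
    Tsup kA s c = Icyc kA (s + 1) ((c : ℕ) : ZMod kA) := by
  unfold Tsup
  split_ifs with h
  · rfl
  · rw [Nat.cast_sub (not_lt.1 h), ZMod.natCast_self, sub_zero]

theorem card_le_card_image_natCast_add (kA s : ℕ) (S : Finset (Fin (kA + s))) :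
    S.card ≤ (S.image fun c : Fin (kA + s) => ((c : ℕ) : ZMod kA)).card + s := by
  rw [← Finset.card_filter_add_card_filter_not (s := S) (fun c => (c : ℕ) < kA)]
  refine add_le_add ?_ ?_
  · refine Finset.card_le_card_of_injOn (fun c => ((c : ℕ) : ZMod kA)) (fun c hc => ?_) ?_
    · exact Finset.mem_coe.2 (Finset.mem_image_of_mem _ (Finset.mem_filter.1 hc).1)
    · intro a ha b hb hab
      have ha' := (Finset.mem_filter.1 ha).2
      have hb' := (Finset.mem_filter.1 hb).2
      exact Fin.ext (((ZMod.natCast_eq_natCast_iff _ _ _).1 hab).eq_of_lt_of_lt ha' hb')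
  · calc _ ≤ (Finset.Ico kA (kA + s)).card := by
          refine Finset.card_le_card_of_injOn (fun c : Fin (kA + s) => (c : ℕ))
            (fun c hc => ?_) Fin.val_injective.injOn
          have := (Finset.mem_filter.1 hc).2
          exact Finset.mem_coe.2 (Finset.mem_Ico.2 ⟨not_lt.1 this, c.2⟩)
      _ = s := by simp

/-- Perfect matching for Algorithm 1: for every subset `C ⊆ Fin n` with `|C| = k_A`,
there is a bijection `f` from `C` onto `ZMod k_A` with `f c ∈ T_c` for every `c ∈ C`. -/
theorem perfect_matching (kA s : ℕ) (hs : 1 ≤ s) (hsk : s < kA)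
    (C : Finset (Fin (kA + s))) (hC : C.card = kA) :
    ∃ f : {c // c ∈ C} → ZMod kA, Function.Bijective f ∧
      ∀ c : {c // c ∈ C}, f c ∈ Tsup kA s c.1 := by
  have : NeZero kA := ⟨by omega⟩
  obtain ⟨f, hf, hfT⟩ := (Finset.all_card_le_biUnion_card_iff_exists_injective
    fun c : {c // c ∈ C} => Tsup kA s c.1).1 fun S => by
      rcases S.eq_empty_or_nonempty with rfl | hS
      · simp
      set S' := S.map (Function.Embedding.subtype _) with hS'
      have hcard : S'.card = S.card := Finset.card_map _
      have hle : S.card ≤ kA := by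
        simpa [hC] using Finset.card_le_univ S
      have himage := card_le_card_image_natCast_add kA s S'
      have hmin := min_le_card_biUnion_Icyc
        (((Finset.map_nonempty (f := Function.Embedding.subtype _)).2 hS).image
          fun c : Fin (kA + s) => ((c : ℕ) : ZMod kA)) s
      have hunion : (S'.image fun c : Fin (kA + s) => ((c : ℕ) : ZMod kA)).biUnion (Icyc kA (s + 1))
          = S.biUnion fun c => Tsup kA s c.1 := by
        ext x
        simp [hS', Tsup_eq_Icyc]
      rw [← hunion]
      exact (le_min hle (hcard ▸ himage)).trans hmin
  refine ⟨f, (Fintype.bijective_iff_injective_and_card f).2 ⟨hf, ?_⟩, hfT⟩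
  simp [hC, ZMod.card]
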